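/- arXiv:1510.07284 — 3 statements merged into one kernel-verified Lean document; each statement's English description precedes it below -/
import Mathlib

section
/- Let X be a standard Gaussian vector in ℝⁿ, and suppose p > (log n)². Then there exist absolute constants c, C > 0 such that P(|‖X‖_p − E‖X‖_p| > ε·E‖X‖_p) ≥ c·e^{−Cε log n} for all 0 < ε < 1. -/
open MeasureTheory ProbabilityTheory

/-- Lower bound for the upper tail of the standard Gaussian. -/
lemma gaussianReal_Ioi_ge {r : ℝ} (hr : 1 ≤ r) :
    (√(2 * Real.pi))⁻¹ * Real.exp (-(r ^ 2 + 3) / 2) / r ≤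
      (gaussianReal 0 1).real (Set.Ioi r) := by
  have hr0 : 0 < r := by linarith
  set m := (√(2 * Real.pi))⁻¹ * Real.exp (-(r ^ 2 + 3) / 2) with hm
  have hm0 : 0 ≤ m := by positivity
  have hsub : Set.Ioc r (r + 1 / r) ⊆ Set.Ioi r := fun x hx => hx.1
  refine le_trans ?_ (measureReal_mono hsub)
  have hreal : (gaussianReal 0 1).real (Set.Ioc r (r + 1 / r)) =
      ∫ x in Set.Ioc r (r + 1 / r), gaussianPDFReal 0 1 x := by
    rw [measureReal_def, gaussianReal_apply_eq_integral 0 one_ne_zero,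
      ENNReal.toReal_ofReal (integral_nonneg fun x => gaussianPDFReal_nonneg 0 1 x)]
  have hconst : m / r = ∫ _ in Set.Ioc r (r + 1 / r), m := by
    simp [hr0.le]
    field_simp
  rw [hreal, hconst]
  refine setIntegral_mono_on (integrableOn_const (by simp))
    (integrable_gaussianPDFReal 0 1).integrableOn measurableSet_Ioc fun x hx => ?_
  rw [gaussianPDFReal, hm]
  simp only [NNReal.coe_one, mul_one, sub_zero]
  gcongr
  have h1 : 1 / r ≤ 1 := by rw [div_le_one hr0]; exact hr
  have h2 : x ^ 2 ≤ (r + 1 / r) ^ 2 := pow_le_pow_left₀ (by linarith [hx.1]) hx.2 2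
  have h3 : (r + 1 / r) ^ 2 = r ^ 2 + 2 + (1 / r) ^ 2 := by field_simp; ring
  have h4 : (1 / r) ^ 2 ≤ 1 := pow_le_one₀ (by positivity) h1
  linarith

/-- The expected excess of the modulus of a standard Gaussian over a level `s`. -/
lemma integral_abs_sub_max_gaussianReal_le {s : ℝ} (hs : 0 < s) :
    ∫ x, max (|x| - s) 0 ∂(gaussianReal 0 1) ≤ 4 * Real.exp (-s ^ 2 / 2) / s ^ 2 := by
  rw [integral_gaussianReal_eq_integral_smul one_ne_zero]
  set f : ℝ → ℝ := fun u => (√(2 * Real.pi))⁻¹ * Real.exp (-u ^ 2 / 2) * max (u - s) 0 with hf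
  have h1 : (fun x : ℝ => gaussianPDFReal 0 1 x • max (|x| - s) 0) = fun x => f |x| := by
    ext x
    simp [hf, gaussianPDFReal]
  have h2 : ∫ u in Set.Ioi 0, f u = ∫ u in Set.Ioi s, f u := by
    refine setIntegral_eq_of_subset_of_forall_sdiff_eq_zero measurableSet_Ioi
      (Set.Ioi_subset_Ioi hs.le) fun x hx => ?_
    have hxs : x ≤ s := by simpa using hx.2
    simp [hf, hxs]
  have hc : (√(2 * Real.pi))⁻¹ ≤ 1 / 2 := by
    rw [inv_le_comm₀ (by positivity) (by norm_num)]
    apply Real.le_sqrt_of_sq_le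
    nlinarith [Real.pi_gt_three]
  have hneg : -(s / 2) < 0 := by linarith
  have h3 : ∫ u in Set.Ioi s, f u ≤
      ∫ u in Set.Ioi s, (1 / 2) * (2 / s) * Real.exp (-(s / 2) * u) := by
    refine integral_mono_of_nonneg (Filter.Eventually.of_forall fun u => ?_)
      ((integrableOn_exp_mul_Ioi hneg s).const_mul _)
      ((ae_restrict_mem measurableSet_Ioi).mono fun u hu => ?_)
    · simp only [hf, Pi.zero_apply]; positivity
    · have hu' : s < u := hu
      have hb : u - s ≤ 2 / s * Real.exp (s / 2 * (u - s)) := by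
        have := Real.add_one_le_exp (s / 2 * (u - s))
        rw [div_mul_eq_mul_div, le_div_iff₀ hs]
        nlinarith
      simp only [hf]
      rw [max_eq_left (by linarith)]
      calc _ ≤ 1 / 2 * Real.exp (-u ^ 2 / 2) * (2 / s * Real.exp (s / 2 * (u - s))) := by
            gcongr
        _ = 1 / 2 * (2 / s) * Real.exp (-u ^ 2 / 2 + s / 2 * (u - s)) := by
            rw [Real.exp_add]; ring
        _ ≤ _ := by
            gcongr
            nlinarith [sq_nonneg (u - s)]
  rw [h1, integral_comp_abs, h2]
  rw [integral_const_mul, integral_exp_mul_Ioi hneg] at h3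
  have h4 : -(s / 2) * s = -s ^ 2 / 2 := by ring
  rw [h4] at h3
  calc _ ≤ 2 * (1 / 2 * (2 / s) * (-Real.exp (-s ^ 2 / 2) / -(s / 2))) := by gcongr
    _ = _ := by field_simp; norm_num

lemma lpNorm_le_rpow_mul_of_abs_le {n : ℕ} {p B : ℝ} (hp : 0 < p) (hB : 0 ≤ B) {x : Fin n → ℝ}
    (h : ∀ i, |x i| ≤ B) : (∑ i, |x i| ^ p) ^ (1 / p) ≤ (n : ℝ) ^ (1 / p) * B := by
  calc _ ≤ (∑ _ : Fin n, B ^ p) ^ (1 / p) := by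
        gcongr with i
        exact h i
    _ = _ := by
        rw [Finset.sum_const, Finset.card_univ, Fintype.card_fin, nsmul_eq_mul,
          Real.mul_rpow (by positivity) (by positivity), one_div, Real.rpow_rpow_inv hB hp.ne']

lemma abs_le_lpNorm {n : ℕ} {p : ℝ} (hp : 0 < p) (x : Fin n → ℝ) (i : Fin n) :
    |x i| ≤ (∑ i, |x i| ^ p) ^ (1 / p) := by
  calc |x i| = (|x i| ^ p) ^ (1 / p) := by
        rw [one_div, Real.rpow_rpow_inv (abs_nonneg _) hp.ne']
    _ ≤ _ := by
        gcongr
        exact Finset.single_le_sum (f := fun i => |x i| ^ p) (fun i _ => by positivity)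
          (Finset.mem_univ i)

lemma integral_lpNorm_gaussian_le {n : ℕ} {p s : ℝ} (hp : 0 < p) (hs : 0 < s) :
    ∫ y, (∑ i, |y i| ^ p) ^ (1 / p) ∂(Measure.pi fun _ : Fin n => gaussianReal 0 1) ≤
      (n : ℝ) ^ (1 / p) * (s + n * (4 * Real.exp (-s ^ 2 / 2) / s ^ 2)) := by
  have hint : Integrable (fun x : ℝ => max (|x| - s) 0) (gaussianReal 0 1) := by
    have : Integrable (fun x : ℝ => x) (gaussianReal 0 1) :=
      (memLp_id_gaussianReal 1).integrable (by simp)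
    exact (this.abs.sub (integrable_const s)).pos_part
  have hint' (i : Fin n) : Integrable (fun y : Fin n → ℝ => max (|y i| - s) 0)
      (Measure.pi fun _ : Fin n => gaussianReal 0 1) :=
    integrable_comp_eval (μ := fun _ : Fin n => gaussianReal 0 1) (i := i) hint
  have hsum : Integrable (fun y : Fin n → ℝ => ∑ i, max (|y i| - s) 0)
      (Measure.pi fun _ : Fin n => gaussianReal 0 1) :=
    integrable_finsetSum _ fun i _ => hint' i
  calc _ ≤ ∫ y : Fin n → ℝ, (n : ℝ) ^ (1 / p) * (s + ∑ i, max (|y i| - s) 0)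
          ∂(Measure.pi fun _ : Fin n => gaussianReal 0 1) := by
        refine integral_mono_of_nonneg (Filter.Eventually.of_forall fun y => ?_)
          (((integrable_const s).add hsum).const_mul _) (Filter.Eventually.of_forall fun y => ?_)
        · simp only [Pi.zero_apply]
          exact Real.rpow_nonneg (Finset.sum_nonneg fun i _ => by positivity) _
        · have h0 : ∀ i ∈ Finset.univ, 0 ≤ max (|y i| - s) 0 := fun i _ => le_max_right _ _
          refine lpNorm_le_rpow_mul_of_abs_le hp
            (add_nonneg hs.le (Finset.sum_nonneg h0)) fun i => ?_
          have := Finset.single_le_sum h0 (Finset.mem_univ i)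
          linarith [le_max_left (|y i| - s) 0]
    _ = (n : ℝ) ^ (1 / p) * (s + n * ∫ x, max (|x| - s) 0 ∂(gaussianReal 0 1)) := by
        rw [integral_const_mul, integral_add (integrable_const s) hsum,
          integral_finsetSum _ fun i _ => hint' i]
        have (i : Fin n) : ∫ y : Fin n → ℝ, max (|y i| - s) 0
            ∂(Measure.pi fun _ : Fin n => gaussianReal 0 1) =
            ∫ x, max (|x| - s) 0 ∂(gaussianReal 0 1) :=
          integral_comp_eval (μ := fun _ : Fin n => gaussianReal 0 1) (i := i)
            hint.aestronglyMeasurable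
        simp [this]
    _ ≤ _ := by
        gcongr
        exact integral_abs_sub_max_gaussianReal_le hs

/-- Probability that some coordinate of a product measure exceeds a level. -/
lemma div_one_add_le_pi_real_exists_lt (μ : Measure ℝ) [IsProbabilityMeasure μ] {n : ℕ} {r a : ℝ}
    (ha : 0 ≤ a) (h : a ≤ n * μ.real (Set.Ioi r)) :
    a / (1 + a) ≤ (Measure.pi fun _ : Fin n => μ).real {x | ∃ i, r < x i} := by
  have hset : {x : Fin n → ℝ | ∃ i, r < x i} = (Set.univ.pi fun _ => Set.Iic r)ᶜ := by
    ext x; simp [Pi.le_def]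
  have hq : μ.real (Set.Iic r) = 1 - μ.real (Set.Ioi r) := by
    rw [← Set.compl_Ioi, probReal_compl_eq_one_sub measurableSet_Ioi]
  have hpi : (Measure.pi fun _ : Fin n => μ).real (Set.univ.pi fun _ => Set.Iic r) =
      (1 - μ.real (Set.Ioi r)) ^ n := by
    rw [← hq, measureReal_def, Measure.pi_pi, measureReal_def]
    simp
  rw [hset, probReal_compl_eq_one_sub (MeasurableSet.univ_pi fun _ => measurableSet_Iic), hpi]
  have h1 : (1 - μ.real (Set.Ioi r)) ^ n ≤ Real.exp (-a) := by
    calc _ ≤ Real.exp (-μ.real (Set.Ioi r)) ^ n := by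
          refine pow_le_pow_left₀ ?_ (Real.one_sub_le_exp_neg _) n
          rw [← hq]; exact measureReal_nonneg
      _ = Real.exp (-(n * μ.real (Set.Ioi r))) := by rw [← Real.exp_nat_mul]; ring_nf
      _ ≤ _ := by gcongr
  have h2 : Real.exp (-a) ≤ 1 / (1 + a) := by
    rw [Real.exp_neg, ← one_div]
    gcongr
    linarith [Real.add_one_le_exp a]
  have h3 : a / (1 + a) = 1 - 1 / (1 + a) := by field_simp; ring
  linarith

/-- The level `√(2 L - log L)` is, up to constants, the typical size of the maximum of `exp L`
standard Gaussians. -/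
lemma sqrt_two_mul_sub_log_bounds {L : ℝ} (hL : 1 ≤ L) :
    √L ≤ √(2 * L - Real.log L) ∧ √(2 * L - Real.log L) ^ 2 ≤ 2 * L ∧
      Real.exp (-√(2 * L - Real.log L) ^ 2 / 2) = √L * Real.exp (-L) := by
  have hL0 : 0 < L := by linarith
  have h1 := Real.log_le_sub_one_of_pos hL0
  have h2 := Real.log_nonneg hL
  refine ⟨Real.sqrt_le_sqrt (by linarith), ?_, ?_⟩
  · rw [Real.sq_sqrt (by linarith)]; linarith
  · rw [Real.sq_sqrt (by linarith), Real.sqrt_eq_rpow, Real.rpow_def_of_pos hL0, ← Real.exp_add]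
    ring_nf

lemma integral_lpNorm_gaussian_le_of_sq_log_lt {n : ℕ} {p : ℝ} (hL : 1 ≤ Real.log n)
    (hp : Real.log n ^ 2 < p) :
    ∫ y, (∑ i, |y i| ^ p) ^ (1 / p) ∂(Measure.pi fun _ : Fin n => gaussianReal 0 1) ≤
      √(2 * Real.log n - Real.log (Real.log n)) * (1 + 14 / Real.log n) := by
  have hn0 : (0 : ℝ) < n := by
    rcases Nat.eq_zero_or_pos n with rfl | h
    · norm_num at hL
    · exact_mod_cast h
  obtain ⟨hs1, -, hs3⟩ := sqrt_two_mul_sub_log_bounds hL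
  set L := Real.log n with hLdef
  set s := √(2 * L - Real.log L)
  have hL0 : 0 < L := by linarith
  have hp0 : 0 < p := lt_of_le_of_lt (sq_nonneg _) hp
  have hsL : 0 < √L := Real.sqrt_pos.2 hL0
  have hs0 : 0 < s := lt_of_lt_of_le hsL hs1
  have hexp : n * Real.exp (-L) = 1 := by
    rw [Real.exp_neg, hLdef, Real.exp_log hn0, mul_inv_cancel₀ hn0.ne']
  have hsq : L ≤ s ^ 2 := by
    rw [← Real.sq_sqrt hL0.le]; exact pow_le_pow_left₀ hsL.le hs1 2
  have h1 : n * (4 * Real.exp (-s ^ 2 / 2) / s ^ 2) ≤ s * (4 / L) := by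
    calc _ = 4 * √L * (n * Real.exp (-L)) / s ^ 2 := by rw [hs3]; ring
      _ = 4 * √L / s ^ 2 := by rw [hexp, mul_one]
      _ ≤ 4 * s / L := by gcongr
      _ = _ := by ring
  have h2 : (n : ℝ) ^ (1 / p) ≤ 1 + 2 / L := by
    have hle : L * (1 / p) ≤ 1 / L := by
      rw [mul_one_div, div_le_div_iff₀ hp0 hL0]; nlinarith
    have hle1 : |1 / L| ≤ 1 := by
      rw [abs_of_pos (by positivity), div_le_one hL0]; exact hL
    have := (abs_le.1 (Real.abs_exp_sub_one_le hle1)).2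
    rw [abs_of_pos (by positivity)] at this
    rw [Real.rpow_def_of_pos hn0, ← hLdef]
    have h' := Real.exp_le_exp.2 hle
    have : 2 * (1 / L) = 2 / L := by ring
    linarith
  have hinv : 1 / L ≤ 1 := by rw [div_le_one hL0]; exact hL
  calc _ ≤ (n : ℝ) ^ (1 / p) * (s + n * (4 * Real.exp (-s ^ 2 / 2) / s ^ 2)) :=
        integral_lpNorm_gaussian_le hp0 hs0
    _ ≤ (1 + 2 / L) * (s + s * (4 / L)) := by gcongr
    _ = s * (1 + (6 + 8 * (1 / L)) * (1 / L)) := by ring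
    _ ≤ s * (1 + (6 + 8 * 1) * (1 / L)) := by gcongr
    _ = _ := by ring

theorem stmt14 :
    ∃ c C : ℝ, 0 < c ∧ 0 < C ∧ ∃ n₀ : ℕ, ∀ n : ℕ, n₀ ≤ n →
      ∀ p : ℝ, (Real.log n) ^ 2 < p → ∀ ε : ℝ, 0 < ε → ε < 1 →
        c * Real.exp (-C * ε * Real.log n) ≤
          ((Measure.pi fun _ : Fin n => gaussianReal 0 1)
            {x | ε * ∫ y, (∑ i, |y i| ^ p) ^ (1 / p)
                  ∂(Measure.pi fun _ : Fin n => gaussianReal 0 1) <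
              |(∑ i, |x i| ^ p) ^ (1 / p) -
                ∫ y, (∑ i, |y i| ^ p) ^ (1 / p)
                  ∂(Measure.pi fun _ : Fin n => gaussianReal 0 1)|}).toReal := by
  set b : ℝ := (√(2 * Real.pi))⁻¹ * Real.exp (-(283 / 2)) / 6 with hb
  have hb0 : 0 < b := by positivity
  refine ⟨b / (1 + b), 5, by positivity, by norm_num, ⌈Real.exp 14⌉₊, fun n hn p hp ε hε hε1 => ?_⟩
  have hn14 : Real.exp 14 ≤ n := Nat.ceil_le.1 hn
  have hn0 : (0 : ℝ) < n := lt_of_lt_of_le (Real.exp_pos _) hn14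
  have hL : 14 ≤ Real.log n := (Real.le_log_iff_exp_le hn0).2 hn14
  have hp0 : 0 < p := lt_of_le_of_lt (sq_nonneg _) hp
  have hE := integral_lpNorm_gaussian_le_of_sq_log_lt (by linarith) hp
  obtain ⟨hs1, hs2, hs3⟩ := sqrt_two_mul_sub_log_bounds (show 1 ≤ Real.log n by linarith)
  have hexp : n * Real.exp (-Real.log n) = 1 := by
    rw [Real.exp_neg, Real.exp_log hn0, mul_inv_cancel₀ hn0.ne']
  set L := Real.log n
  set s := √(2 * L - Real.log L)
  set E := ∫ y, (∑ i, |y i| ^ p) ^ (1 / p) ∂(Measure.pi fun _ : Fin n => gaussianReal 0 1)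
  have hL0 : 0 < L := by linarith
  have hs_one : 1 ≤ s := le_trans (Real.one_le_sqrt.2 (by linarith)) hs1
  have hs0 : 0 < s := by linarith
  set δ := ε + 14 / L * (1 + ε) with hδ
  have hinv : 14 / L ≤ 1 := by rw [div_le_one hL0]; exact hL
  have hinv0 : 0 < 14 / L := by positivity
  have hδ0 : 0 < δ := by positivity
  have hδ3 : δ ≤ 3 := by rw [hδ]; nlinarith
  have hδL : L * δ ≤ L * ε + 28 := by
    have : L * δ = L * ε + 14 * (1 + ε) := by rw [hδ]; field_simp
    linarith
  set r := s * (1 + δ) with hr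
  have hr1 : 1 ≤ r := by rw [hr]; nlinarith
  have hEr : (1 + ε) * E ≤ r := by
    calc _ ≤ (1 + ε) * (s * (1 + 14 / L)) := by gcongr
      _ = r := by rw [hr, hδ]; ring
  have hr2 : r ^ 2 ≤ s ^ 2 + 10 * (L * ε) + 280 := by
    have h1 : (1 + δ) ^ 2 ≤ 1 + 5 * δ := by nlinarith
    calc r ^ 2 = s ^ 2 * (1 + δ) ^ 2 := by rw [hr]; ring
      _ ≤ s ^ 2 * (1 + 5 * δ) := by gcongr
      _ = s ^ 2 + s ^ 2 * (5 * δ) := by ring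
      _ ≤ s ^ 2 + 2 * L * (5 * δ) := by gcongr
      _ ≤ _ := by linarith
  have hr6 : r ≤ 6 * √L := by
    have hsq : s ≤ 3 / 2 * √L := by
      refine (sq_le_sq₀ hs0.le (by positivity)).1 ?_
      rw [mul_pow, Real.sq_sqrt hL0.le]; linarith
    calc r ≤ 3 / 2 * √L * (1 + 3) := by rw [hr]; gcongr
      _ = _ := by ring
  have ha : b * Real.exp (-5 * ε * L) ≤ n * (gaussianReal 0 1).real (Set.Ioi r) := by
    have hsL : 0 < √L := Real.sqrt_pos.2 hL0
    calc b * Real.exp (-5 * ε * L)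
        = n * Real.exp (-L) * (b * Real.exp (-5 * ε * L)) := by rw [hexp, one_mul]
      _ = n * ((√(2 * Real.pi))⁻¹ * ((√L * Real.exp (-L)) *
            (Real.exp (-5 * ε * L) * Real.exp (-(283 / 2)))) / (6 * √L)) := by
          rw [hb]; field_simp
      _ = n * ((√(2 * Real.pi))⁻¹ *
            Real.exp (-(s ^ 2 + 10 * (L * ε) + 280 + 3) / 2) / (6 * √L)) := by
          rw [← hs3, ← Real.exp_add, ← Real.exp_add]; ring_nf
      _ ≤ n * ((√(2 * Real.pi))⁻¹ * Real.exp (-(r ^ 2 + 3) / 2) / r) := by gcongr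
      _ ≤ _ := by gcongr; exact gaussianReal_Ioi_ge hr1
  calc b / (1 + b) * Real.exp (-5 * ε * L)
      = b * Real.exp (-5 * ε * L) / (1 + b * 1) := by ring
    _ ≤ b * Real.exp (-5 * ε * L) / (1 + b * Real.exp (-5 * ε * L)) := by
        gcongr
        rw [Real.exp_le_one_iff]
        have : 0 < ε * L := by positivity
        linarith
    _ ≤ (Measure.pi fun _ : Fin n => gaussianReal 0 1).real {x | ∃ i, r < x i} :=
        div_one_add_le_pi_real_exists_lt _ (by positivity) ha
    _ ≤ _ := by
        refine measureReal_mono fun x hx => ?_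
        obtain ⟨i, hi⟩ := hx
        have h1 := abs_le_lpNorm hp0 x i
        have h2 := le_abs_self (x i)
        have h3 : ε * E < (∑ i, |x i| ^ p) ^ (1 / p) - E := by linarith
        exact h3.trans_le (le_abs_self _)
end

section
/- Let X be a standard Gaussian vector in ℝⁿ with p > (log n)². Then Var‖X‖_p ≥ c/log n for an absolute constant c > 0 and sufficiently large n. -/
open MeasureTheory ProbabilityTheory

section Gaussian

theorem gaussianReal_zero_one_Ioi_le {t : ℝ} (ht : 0 < t) :
    (gaussianReal 0 1).real (Set.Ioi t) ≤
      (√(2 * Real.pi))⁻¹ * (Real.exp (-t ^ 2 / 2) / t) := by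
  have hderiv : ∀ x ∈ Set.Ici t,
      HasDerivAt (fun u : ℝ => -((√(2 * Real.pi))⁻¹ * (Real.exp (-u ^ 2 / 2) / t)))
        ((√(2 * Real.pi))⁻¹ * (x / t * Real.exp (-x ^ 2 / 2))) x := by
    intro x _
    have h : HasDerivAt (fun u : ℝ => -u ^ 2 / 2) (-x) x := by
      convert! ((hasDerivAt_pow 2 x).neg.div_const 2) using 1
      norm_num
      ring
    convert! ((h.exp.div_const t).const_mul (√(2 * Real.pi))⁻¹).neg using 1
    ring
  have hnonneg : ∀ x ∈ Set.Ioi t,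
      0 ≤ (√(2 * Real.pi))⁻¹ * (x / t * Real.exp (-x ^ 2 / 2)) := by
    intro x hx
    have : 0 < x := ht.trans hx
    positivity
  have hlim : Filter.Tendsto (fun u : ℝ => -((√(2 * Real.pi))⁻¹ * (Real.exp (-u ^ 2 / 2) / t)))
      Filter.atTop (nhds 0) := by
    have h : Filter.Tendsto (fun u : ℝ => -u ^ 2 / 2) Filter.atTop Filter.atBot := by
      have := (Filter.tendsto_pow_atTop (α := ℝ) two_ne_zero).atTop_div_const
        (two_pos : (0 : ℝ) < 2)
      refine (Filter.tendsto_neg_atTop_atBot.comp this).congr fun u => ?_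
      simp [neg_div]
    simpa using (((Real.tendsto_exp_atBot.comp h).div_const t).const_mul
      (√(2 * Real.pi))⁻¹).neg
  have hint := integral_Ioi_of_hasDerivAt_of_nonneg' hderiv hnonneg hlim
  rw [zero_sub, neg_neg] at hint
  rw [measureReal_def, gaussianReal_apply_eq_integral _ one_ne_zero, ENNReal.toReal_ofReal
    (integral_nonneg fun x => gaussianPDFReal_nonneg _ _ _), ← hint]
  refine setIntegral_mono_on (integrable_gaussianPDFReal 0 1).integrableOn
    (integrableOn_Ioi_deriv_of_nonneg' hderiv hnonneg hlim) measurableSet_Ioi fun x hx => ?_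
  have h1 : 1 ≤ x / t := (one_le_div ht).2 (le_of_lt hx)
  simp only [gaussianPDFReal, sub_zero, NNReal.coe_one, mul_one]
  gcongr
  exact le_mul_of_one_le_left (Real.exp_pos _).le h1

theorem le_gaussianReal_zero_one_Ioi {b h : ℝ} (hb : 0 ≤ b) (hh : 0 ≤ h) :
    h * ((√(2 * Real.pi))⁻¹ * Real.exp (-(b + h) ^ 2 / 2)) ≤
      (gaussianReal 0 1).real (Set.Ioi b) := by
  calc h * ((√(2 * Real.pi))⁻¹ * Real.exp (-(b + h) ^ 2 / 2))
      = ∫ _ in Set.Ioc b (b + h), (√(2 * Real.pi))⁻¹ * Real.exp (-(b + h) ^ 2 / 2) := by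
        rw [setIntegral_const, Real.volume_real_Ioc_of_le (by linarith), smul_eq_mul,
          add_sub_cancel_left]
    _ ≤ ∫ x in Set.Ioc b (b + h), gaussianPDFReal 0 1 x := by
        refine setIntegral_mono_on (integrableOn_const measure_Ioc_lt_top.ne)
          (integrable_gaussianPDFReal 0 1).integrableOn measurableSet_Ioc fun x hx => ?_
        have hx0 : 0 ≤ x := hb.trans hx.1.le
        simp only [gaussianPDFReal, sub_zero, NNReal.coe_one, mul_one]
        gcongr
        exact hx.2
    _ = (gaussianReal 0 1).real (Set.Ioc b (b + h)) := by
        rw [measureReal_def, gaussianReal_apply_eq_integral _ one_ne_zero, ENNReal.toReal_ofReal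
          (integral_nonneg fun x => gaussianPDFReal_nonneg _ _ _)]
    _ ≤ _ := measureReal_mono Set.Ioc_subset_Ioi_self

theorem gaussianReal_zero_one_Iio_neg (t : ℝ) :
    (gaussianReal 0 1).real (Set.Iio (-t)) = (gaussianReal 0 1).real (Set.Ioi t) := by
  have h := gaussianReal_map_neg (μ := 0) (v := 1)
  rw [neg_zero] at h
  conv_rhs => rw [← h]
  rw [map_measureReal_apply measurable_neg measurableSet_Ioi]
  congr 1
  ext x
  simp

theorem one_sub_le_gaussianReal_zero_one_Icc (t : ℝ) :
    1 - 2 * (gaussianReal 0 1).real (Set.Ioi t) ≤ (gaussianReal 0 1).real (Set.Icc (-t) t) := by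
  have hc := probReal_compl_eq_one_sub (μ := gaussianReal 0 1) (s := Set.Icc (-t) t)
    measurableSet_Icc
  have hsub : (Set.Icc (-t) t)ᶜ ⊆ Set.Iio (-t) ∪ Set.Ioi t := by
    intro x hx
    by_contra! hcon
    simp only [Set.mem_union, Set.mem_Iio, Set.mem_Ioi, not_or, not_lt] at hcon
    exact hx hcon
  have h1 := measureReal_mono (μ := gaussianReal 0 1) hsub
  have h2 := measureReal_union_le (μ := gaussianReal 0 1) (Set.Iio (-t)) (Set.Ioi t)
  rw [gaussianReal_zero_one_Iio_neg] at h2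
  linarith

end Gaussian

section Product

variable {n : ℕ} (μ : Measure ℝ) [IsProbabilityMeasure μ]

theorem pi_real_univ_pi_const (s : Set ℝ) :
    (Measure.pi fun _ : Fin n => μ).real (Set.univ.pi fun _ => s) = μ.real s ^ n := by
  simp [measureReal_def]

theorem one_sub_exp_le_pi_real_exists_lt (b : ℝ) :
    1 - Real.exp (-(n * μ.real (Set.Ioi b))) ≤
      (Measure.pi fun _ : Fin n => μ).real {x | ∃ i, b < x i} := by
  have hset : {x : Fin n → ℝ | ∃ i, b < x i} = (Set.univ.pi fun _ => Set.Iic b)ᶜ := by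
    ext x
    simp [Pi.le_def]
  have hIic : μ.real (Set.Iic b) = 1 - μ.real (Set.Ioi b) := by
    rw [← probReal_compl_eq_one_sub measurableSet_Ioi, Set.compl_Ioi]
  rw [hset, probReal_compl_eq_one_sub (MeasurableSet.univ_pi fun _ => measurableSet_Iic),
    pi_real_univ_pi_const]
  have h : μ.real (Set.Iic b) ^ n ≤ Real.exp (-μ.real (Set.Ioi b)) ^ n := by
    gcongr
    rw [hIic]
    linarith [Real.add_one_le_exp (-μ.real (Set.Ioi b))]
  rw [← Real.exp_nat_mul, mul_neg] at h
  linarith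

end Product

theorem mul_sq_le_integral_sub_sq {Ω : Type*} [MeasurableSpace Ω] {P : Measure Ω}
    [IsFiniteMeasure P] {f : Ω → ℝ} (hf : MemLp f 2 P) {a b κ : ℝ} (hab : a ≤ b)
    (ha : κ ≤ P.real {x | f x ≤ a}) (hb : κ ≤ P.real {x | b ≤ f x}) (m : ℝ) :
    ((b - a) / 2) ^ 2 * κ ≤ ∫ x, (f x - m) ^ 2 ∂P := by
  refine le_trans ?_ (mul_meas_ge_le_integral_of_nonneg (ae_of_all _ fun x => sq_nonneg _)
    (hf.sub (memLp_const m)).integrable_sq (((b - a) / 2) ^ 2))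
  gcongr
  rcases le_total m ((a + b) / 2) with hm | hm
  · refine hb.trans (measureReal_mono fun x hx => ?_)
    simp only [Set.mem_ofPred_eq, Pi.sub_apply] at hx ⊢
    exact pow_le_pow_left₀ (by linarith) (by linarith) 2
  · refine ha.trans (measureReal_mono fun x hx => ?_)
    simp only [Set.mem_ofPred_eq, Pi.sub_apply] at hx ⊢
    rw [← neg_sq (f x - m)]
    exact pow_le_pow_left₀ (by linarith) (by linarith) 2

section LpNorm

variable {n : ℕ} {p : ℝ}

theorem abs_le_sum_rpow (hp : 0 < p) (x : Fin n → ℝ) (i : Fin n) :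
    |x i| ≤ (∑ i, |x i| ^ p) ^ (1 / p) := by
  calc |x i| = (|x i| ^ p) ^ (1 / p) := by
        rw [one_div, Real.rpow_rpow_inv (abs_nonneg _) hp.ne']
    _ ≤ _ := by
        gcongr
        exact Finset.single_le_sum (f := fun i => |x i| ^ p) (fun j _ => by positivity)
          (Finset.mem_univ i)

theorem sum_rpow_le_of_abs_le (hp : 0 < p) {x : Fin n → ℝ} {m : ℝ} (hm : 0 ≤ m)
    (hx : ∀ i, |x i| ≤ m) :
    (∑ i, |x i| ^ p) ^ (1 / p) ≤ (n : ℝ) ^ (1 / p) * m := by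
  calc (∑ i, |x i| ^ p) ^ (1 / p) ≤ (∑ _i : Fin n, m ^ p) ^ (1 / p) := by
        gcongr with i
        exact hx i
    _ = (n : ℝ) ^ (1 / p) * m := by
        rw [Finset.sum_const, Finset.card_univ, Fintype.card_fin, nsmul_eq_mul,
          Real.mul_rpow (by positivity) (by positivity), one_div, Real.rpow_rpow_inv hm hp.ne']

theorem memLp_sum_rpow (hp : 0 < p) :
    MemLp (fun x : Fin n → ℝ => (∑ i, |x i| ^ p) ^ (1 / p)) 2
      (Measure.pi fun _ : Fin n => gaussianReal 0 1) := by
  have hcoord : ∀ i : Fin n, MemLp (fun x : Fin n → ℝ => |x i|) 2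
      (Measure.pi fun _ : Fin n => gaussianReal 0 1) := fun i =>
    ((memLp_id_gaussianReal (μ := 0) (v := 1) 2).comp_measurePreserving
      (measurePreserving_eval (fun _ : Fin n => gaussianReal 0 1) i)).abs
  have hsum := (memLp_finsetSum Finset.univ fun i _ => hcoord i).const_mul ((n : ℝ) ^ (1 / p))
  refine hsum.mono (Measurable.aestronglyMeasurable (by fun_prop)) (ae_of_all _ fun x => ?_)
  rw [Real.norm_of_nonneg (by positivity), Real.norm_of_nonneg (by positivity)]
  exact sum_rpow_le_of_abs_le hp (by positivity) fun i =>
    Finset.single_le_sum (f := fun i => |x i|) (fun j _ => abs_nonneg _) (Finset.mem_univ i)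

end LpNorm

theorem exists_mul_exp_sq_eq {L : ℝ} (hL : 1 ≤ L) :
    ∃ t, √L ≤ t ∧ t ≤ √(2 * L) ∧ t * Real.exp (t ^ 2 / 2) = Real.exp L := by
  have hL0 : 0 ≤ L := by linarith
  have hle : √L ≤ √(2 * L) := Real.sqrt_le_sqrt (by linarith)
  have hcont : ContinuousOn (fun t : ℝ => t * Real.exp (t ^ 2 / 2)) (Set.Icc (√L) (√(2 * L))) := by
    fun_prop
  have hlow : √L * Real.exp (√L ^ 2 / 2) ≤ Real.exp L := by
    have h : √L ≤ Real.exp (L / 2) := by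
      rw [Real.sqrt_le_left (Real.exp_pos _).le, ← Real.exp_nat_mul]
      push_cast
      rw [mul_div_cancel₀ _ two_ne_zero]
      linarith [Real.add_one_le_exp L]
    rw [Real.sq_sqrt hL0]
    calc √L * Real.exp (L / 2) ≤ Real.exp (L / 2) * Real.exp (L / 2) := by gcongr
      _ = Real.exp L := by rw [← Real.exp_add]; ring_nf
  have hhigh : Real.exp L ≤ √(2 * L) * Real.exp (√(2 * L) ^ 2 / 2) := by
    rw [Real.sq_sqrt (by linarith), mul_div_cancel_left₀ _ two_ne_zero]
    exact le_mul_of_one_le_left (Real.exp_pos _).le (Real.one_le_sqrt.2 (by linarith))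
  obtain ⟨t, ht, hteq⟩ := intermediate_value_Icc hle hcont ⟨hlow, hhigh⟩
  exact ⟨t, ht.1, ht.2, hteq⟩

theorem stmt15 :
    ∃ c : ℝ, 0 < c ∧ ∃ n₀ : ℕ, ∀ n : ℕ, n₀ ≤ n → ∀ p : ℝ, (Real.log n) ^ 2 < p →
      c / Real.log n ≤
        ∫ x, ((∑ i, |x i| ^ p) ^ (1 / p) -
            ∫ y, (∑ i, |y i| ^ p) ^ (1 / p)
              ∂(Measure.pi fun _ : Fin n => gaussianReal 0 1)) ^ 2
          ∂(Measure.pi fun _ : Fin n => gaussianReal 0 1) := by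
  have hexp : Real.exp (-Real.exp (-44)) < 1 := by
    rw [Real.exp_lt_one_iff]
    linarith [Real.exp_pos (-44)]
  set κ : ℝ := min (1 / 5) (1 - Real.exp (-Real.exp (-44)))
  have hκ0 : 0 < κ := lt_min (by norm_num) (by linarith)
  refine ⟨κ / 4, by positivity, 3, fun n hn p hp => ?_⟩
  have hn3 : (3 : ℝ) ≤ n := by exact_mod_cast hn
  have hn0 : (0 : ℝ) < n := by linarith
  set L := Real.log n
  have hL : 1 ≤ L := (Real.le_log_iff_exp_le hn0).2 (by linarith [Real.exp_one_lt_d9])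
  have hexpL : Real.exp L = n := Real.exp_log hn0
  have hp1 : L < p := by nlinarith
  have hp0 : 0 < p := by linarith
  set S := √L
  have hSS : S ^ 2 = L := Real.sq_sqrt (by linarith)
  have hS1 : 1 ≤ S := Real.one_le_sqrt.2 hL
  obtain ⟨t, htl, htu, hteq⟩ := exists_mul_exp_sq_eq hL
  rw [hexpL] at hteq
  have ht0 : 0 < t := by linarith
  have htS : t ≤ 3 / 2 * S := by
    refine htu.trans ?_
    rw [Real.sqrt_le_left (by positivity), mul_pow, hSS]
    linarith
  have hgauss : Real.exp (-t ^ 2 / 2) = t / n := by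
    rw [neg_div, Real.exp_neg, ← hteq]
    field_simp
  have hsqrt_lower : (5 : ℝ) / 2 ≤ √(2 * Real.pi) :=
    Real.le_sqrt_of_sq_le (by linarith [Real.pi_gt_d2])
  have hsqrt_upper : √(2 * Real.pi) ≤ 4 :=
    (Real.sqrt_le_left (by norm_num)).2 (by linarith [Real.pi_le_four])
  -- Shifting `t` by `4 / S` changes the Gaussian tail by a bounded factor only.
  set h := 4 / S with hh
  have hh0 : 0 < h := by positivity
  have hh4 : h ≤ 4 := div_le_self (by norm_num) hS1
  have hht4 : 4 ≤ h * t := by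
    rw [hh, div_mul_eq_mul_div, le_div_iff₀ (by linarith)]
    linarith
  have hht6 : h * t ≤ 6 := by
    rw [hh, div_mul_eq_mul_div, div_le_iff₀ (by linarith)]
    linarith
  have hroot : (n : ℝ) ^ (1 / p) ≤ 1 + 2 / L := by
    have hLp : L * (1 / p) ≤ 1 / L := by
      rw [mul_one_div, div_le_div_iff₀ hp0 (by linarith)]
      linarith [sq L]
    have hL1 : 1 / L ≤ 1 := (div_le_one (by linarith)).2 hL
    have hb := Real.abs_exp_sub_one_le (x := 1 / L) (by rwa [abs_of_pos (by positivity)])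
    rw [abs_of_pos (by positivity : 0 < 1 / L)] at hb
    calc (n : ℝ) ^ (1 / p) = Real.exp (L * (1 / p)) := Real.rpow_def_of_pos hn0 _
      _ ≤ Real.exp (1 / L) := Real.exp_le_exp.2 hLp
      _ ≤ 1 + 2 / L := by linarith [le_abs_self (Real.exp (1 / L) - 1), mul_one_div 2 L]
  have hmul : (n : ℝ) ^ (1 / p) * t ≤ t + 3 / S := by
    have h3 : 2 / L * t ≤ 3 / S := by
      rw [← hSS, div_mul_eq_mul_div, div_le_div_iff₀ (by positivity) (by positivity)]
      nlinarith
    nlinarith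
  have hlow : κ ≤ (Measure.pi fun _ : Fin n => gaussianReal 0 1).real
      {x | (∑ i, |x i| ^ p) ^ (1 / p) ≤ t + 3 / S} := by
    have htail : (gaussianReal 0 1).real (Set.Ioi t) ≤ 2 / 5 / n := by
      refine (gaussianReal_zero_one_Ioi_le ht0).trans ?_
      have h1 : (√(2 * Real.pi))⁻¹ ≤ 2 / 5 := by
        rw [inv_le_comm₀ (by positivity) (by norm_num)]
        linarith
      have h2 : Real.exp (-t ^ 2 / 2) / t = 1 / n := by
        rw [hgauss]
        field_simp
      rw [h2, mul_one_div]
      gcongr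
    have hle : (gaussianReal 0 1).real (Set.Ioi t) ≤ 1 / 2 :=
      htail.trans ((div_le_self (by norm_num) (by linarith)).trans (by norm_num))
    calc κ ≤ 1 / 5 := min_le_left _ _
      _ = 1 + n * (-(2 * (2 / 5 / n))) := by field_simp; norm_num
      _ ≤ 1 + n * (-(2 * (gaussianReal 0 1).real (Set.Ioi t))) := by gcongr
      _ ≤ (1 + -(2 * (gaussianReal 0 1).real (Set.Ioi t))) ^ n :=
        one_add_mul_le_pow (by linarith) n
      _ ≤ (gaussianReal 0 1).real (Set.Icc (-t) t) ^ n := by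
        refine pow_le_pow_left₀ (by linarith) ?_ n
        linarith [one_sub_le_gaussianReal_zero_one_Icc t]
      _ = _ := (pi_real_univ_pi_const _ _).symm
      _ ≤ _ := by
        refine measureReal_mono fun x hx => ?_
        refine (sum_rpow_le_of_abs_le hp0 ht0.le fun i => ?_).trans hmul
        exact abs_le.2 (hx i (Set.mem_univ i))
  have hhigh : κ ≤ (Measure.pi fun _ : Fin n => gaussianReal 0 1).real
      {x | t + h ≤ (∑ i, |x i| ^ p) ^ (1 / p)} := by
    have htail : Real.exp (-44) ≤ n * (gaussianReal 0 1).real (Set.Ioi (t + h)) := by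
      have h1 : (1 : ℝ) / 4 ≤ (√(2 * Real.pi))⁻¹ := by
        rw [one_div]
        exact inv_anti₀ (by positivity) hsqrt_upper
      have h2 : t / n * Real.exp (-44) ≤ Real.exp (-(t + h + h) ^ 2 / 2) := by
        rw [← hgauss, ← Real.exp_add, Real.exp_le_exp]
        nlinarith
      calc Real.exp (-44) ≤ h * t * (1 / 4) * Real.exp (-44) :=
            le_mul_of_one_le_left (Real.exp_pos _).le (by linarith)
        _ = n * (h * (1 / 4 * (t / n * Real.exp (-44)))) := by field_simp
        _ ≤ n * (h * ((√(2 * Real.pi))⁻¹ * Real.exp (-(t + h + h) ^ 2 / 2))) := by gcongr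
        _ ≤ _ := by
          gcongr
          exact le_gaussianReal_zero_one_Ioi (by positivity) hh0.le
    calc κ ≤ 1 - Real.exp (-Real.exp (-44)) := min_le_right _ _
      _ ≤ 1 - Real.exp (-(n * (gaussianReal 0 1).real (Set.Ioi (t + h)))) := by gcongr
      _ ≤ _ := one_sub_exp_le_pi_real_exists_lt _ _
      _ ≤ _ := by
        refine measureReal_mono fun x hx => ?_
        obtain ⟨i, hi⟩ := hx
        exact hi.le.trans ((le_abs_self _).trans (abs_le_sum_rpow hp0 x i))
  have hgap : t + h - (t + 3 / S) = 1 / S := by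
    rw [hh]
    ring
  have hS0 : 0 < 1 / S := by positivity
  have key := mul_sq_le_integral_sub_sq (memLp_sum_rpow hp0) (by linarith) hlow hhigh
    (∫ y, (∑ i, |y i| ^ p) ^ (1 / p) ∂(Measure.pi fun _ : Fin n => gaussianReal 0 1))
  refine le_trans (le_of_eq ?_) key
  rw [hgap, ← hSS]
  field_simp
  norm_num
end

section
/- Let Z be a standard Gaussian vector in ℝⁿ (n ≥ 2). Then there exist absolute constants c, C > 0 such that c/log n ≤ Var‖Z‖_∞ ≤ C/log n. -/
open MeasureTheory ProbabilityTheory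

/-- The two-sided tail of the standard Gaussian law (for `0 ≤ t`). -/
noncomputable def gaussianTail (t : ℝ) : ℝ :=
  2 * ∫ x in Set.Ioi t, gaussianPDFReal 0 1 x

lemma gaussianPDFReal_std_add (x s : ℝ) :
    gaussianPDFReal 0 1 (x + s) =
      Real.exp (-(x * s) - s ^ 2 / 2) * gaussianPDFReal 0 1 x := by
  simp only [gaussianPDFReal_def, NNReal.coe_one, mul_one, sub_zero]
  rw [mul_left_comm, ← Real.exp_add]
  ring_nf

lemma gaussianPDFReal_std_neg (x : ℝ) : gaussianPDFReal 0 1 (-x) = gaussianPDFReal 0 1 x := by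
  simp [gaussianPDFReal_def]

lemma gaussianPDFReal_std_le_of_le {x y : ℝ} (hx : 0 ≤ x) (hxy : x ≤ y) :
    gaussianPDFReal 0 1 y ≤ gaussianPDFReal 0 1 x := by
  simp only [gaussianPDFReal_def, NNReal.coe_one, mul_one, sub_zero]
  gcongr

lemma continuous_gaussianPDFReal_std : Continuous (gaussianPDFReal 0 1) := by
  simp only [gaussianPDFReal_def]
  fun_prop

lemma gaussianTail_sub {t d : ℝ} :
    gaussianTail t - gaussianTail (t + d) = 2 * ∫ x in t..(t + d), gaussianPDFReal 0 1 x := by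
  rw [gaussianTail, gaussianTail, ← mul_sub, intervalIntegral.integral_Ioi_sub_Ioi'
    (integrable_gaussianPDFReal 0 1).integrableOn (integrable_gaussianPDFReal 0 1).integrableOn]

lemma gaussianTail_nonneg (t : ℝ) : 0 ≤ gaussianTail t :=
  mul_nonneg zero_le_two (integral_nonneg fun x => gaussianPDFReal_nonneg 0 1 x)

lemma gaussianTail_sub_le {t d : ℝ} (ht : 0 ≤ t) (hd : 0 ≤ d) :
    gaussianTail t - gaussianTail (t + d) ≤ 2 * d * gaussianPDFReal 0 1 t := by
  rw [gaussianTail_sub]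
  have h := intervalIntegral.integral_mono_on (f := gaussianPDFReal 0 1)
    (g := fun _ => gaussianPDFReal 0 1 t) (μ := volume) (le_add_of_nonneg_right hd)
    (continuous_gaussianPDFReal_std.intervalIntegrable _ _) (by simp)
    (fun x hx => gaussianPDFReal_std_le_of_le ht hx.1)
  simp at h
  linarith

lemma le_gaussianTail {t d : ℝ} (ht : 0 ≤ t) (hd : 0 ≤ d) :
    2 * d * gaussianPDFReal 0 1 (t + d) ≤ gaussianTail t := by
  have h := intervalIntegral.integral_mono_on (g := gaussianPDFReal 0 1)
    (f := fun _ => gaussianPDFReal 0 1 (t + d)) (μ := volume) (le_add_of_nonneg_right hd)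
    (by simp) (continuous_gaussianPDFReal_std.intervalIntegrable _ _)
    (fun x hx => gaussianPDFReal_std_le_of_le (ht.trans hx.1) hx.2)
  have h2 := gaussianTail_sub (t := t) (d := d)
  have h3 := gaussianTail_nonneg (t + d)
  simp at h
  linarith

lemma continuous_gaussianTail : Continuous gaussianTail := by
  have h : gaussianTail = fun t =>
      gaussianTail 0 - 2 * ∫ x in (0 : ℝ)..t, gaussianPDFReal 0 1 x := by
    ext t
    have := gaussianTail_sub (t := 0) (d := t)
    rw [zero_add] at this
    linarith
  rw [h]
  exact continuous_const.sub (continuous_const.mul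
    (intervalIntegral.continuous_primitive
      (fun a b => continuous_gaussianPDFReal_std.intervalIntegrable a b) 0))

lemma setIntegral_Iio_neg_gaussianPDFReal (t : ℝ) :
    ∫ x in Set.Iio (-t), gaussianPDFReal 0 1 x = ∫ x in Set.Ioi t, gaussianPDFReal 0 1 x := by
  have := integral_comp_neg_Iic (-t) (gaussianPDFReal 0 1)
  simp only [gaussianPDFReal_std_neg, neg_neg] at this
  rw [← this, integral_Iic_eq_integral_Iio]

lemma gaussianReal_lt_abs {t : ℝ} (ht : 0 ≤ t) :
    (gaussianReal 0 1).real {x | t < |x|} = gaussianTail t := by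
  have hset : {x : ℝ | t < |x|} = Set.Ioi t ∪ Set.Iio (-t) := by
    ext x
    simp [lt_abs, lt_neg]
  have hd : Disjoint (Set.Ioi t) (Set.Iio (-t)) := by
    rw [Set.disjoint_left]
    intro x hx hx'
    simp only [Set.mem_Ioi, Set.mem_Iio] at hx hx'
    linarith
  rw [Measure.real, gaussianReal_apply_eq_integral 0 one_ne_zero, ENNReal.toReal_ofReal
    (integral_nonneg fun x => gaussianPDFReal_nonneg 0 1 x), hset,
    setIntegral_union hd measurableSet_Iio (integrable_gaussianPDFReal 0 1).integrableOn
      (integrable_gaussianPDFReal 0 1).integrableOn,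
    setIntegral_Iio_neg_gaussianPDFReal, gaussianTail, two_mul]

lemma gaussianTail_le_one {t : ℝ} (ht : 0 ≤ t) : gaussianTail t ≤ 1 := by
  rw [← gaussianReal_lt_abs ht]
  exact measureReal_le_one

lemma gaussianTail_zero : gaussianTail 0 = 1 := by
  have h := integral_add_compl (μ := volume) (measurableSet_Ioi (a := (0 : ℝ)))
    (integrable_gaussianPDFReal 0 1)
  rw [Set.compl_Ioi, integral_Iic_eq_integral_Iio, integral_gaussianPDFReal_eq_one 0 one_ne_zero]
    at h
  have h2 := setIntegral_Iio_neg_gaussianPDFReal 0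
  rw [neg_zero] at h2
  rw [gaussianTail]
  linarith

lemma gaussianTail_add_le {t s : ℝ} (hs : 0 ≤ s) :
    gaussianTail (t + s) ≤ Real.exp (-(t * s) - s ^ 2 / 2) * gaussianTail t := by
  have h : ∫ x in Set.Ioi (t + s), gaussianPDFReal 0 1 x
      = ∫ x in Set.Ioi t, gaussianPDFReal 0 1 (x + s) := by
    rw [← (measurePreserving_add_right volume s).setIntegral_preimage_emb
      (measurableEmbedding_addRight s)]
    simp
  rw [gaussianTail, gaussianTail, h, mul_left_comm]
  gcongr 2 * ?_
  rw [← integral_const_mul]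
  refine setIntegral_mono_on ?_ ?_ measurableSet_Ioi ?_
  · exact ((integrable_gaussianPDFReal 0 1).comp_add_right s).integrableOn
  · exact ((integrable_gaussianPDFReal 0 1).const_mul _).integrableOn
  · intro x hx
    rw [gaussianPDFReal_std_add]
    gcongr
    · exact gaussianPDFReal_nonneg 0 1 x
    · exact (Set.mem_Ioi.1 hx).le

lemma gaussianTail_le_exp {t : ℝ} (ht : 0 ≤ t) : gaussianTail t ≤ Real.exp (-(t ^ 2 / 2)) := by
  simpa [gaussianTail_zero] using gaussianTail_add_le (t := 0) ht

lemma gaussianPDFReal_std_zero_le : gaussianPDFReal 0 1 0 ≤ 1 / 2 := by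
  simp only [gaussianPDFReal_def, NNReal.coe_one, mul_one, sub_zero]
  have h : (2 : ℝ) ≤ √(2 * Real.pi) := by
    apply Real.le_sqrt_of_sq_le
    linarith [Real.pi_gt_three]
  have := inv_anti₀ two_pos h
  simpa using this

lemma one_third_le_gaussianPDFReal_std_zero : 1 / 3 ≤ gaussianPDFReal 0 1 0 := by
  simp only [gaussianPDFReal_def, NNReal.coe_one, mul_one, sub_zero]
  have h : √(2 * Real.pi) ≤ 3 := by
    rw [Real.sqrt_le_iff]
    constructor <;> linarith [Real.pi_lt_four]
  have := inv_anti₀ (by positivity) h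
  simpa using this

lemma half_le_of_gaussianTail_le {a : ℝ} (ha : 0 ≤ a) (h : gaussianTail a ≤ 1 / 2) :
    1 / 2 ≤ a := by
  have h1 := gaussianTail_sub_le le_rfl ha
  rw [zero_add, gaussianTail_zero] at h1
  nlinarith [gaussianPDFReal_std_zero_le]

lemma gaussianPDFReal_le_mul_gaussianTail {a : ℝ} (ha : 1 / 2 ≤ a) :
    2 * gaussianPDFReal 0 1 a ≤ a * Real.exp 3 * gaussianTail a := by
  have ha0 : 0 < a := by linarith
  have h := le_gaussianTail ha0.le (d := 1 / a) (by positivity)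
  rw [gaussianPDFReal_std_add] at h
  have he : Real.exp (-3) ≤ Real.exp (-(a * (1 / a)) - (1 / a) ^ 2 / 2) := by
    have : 1 / a ≤ 2 := by
      rw [div_le_iff₀ ha0]
      linarith
    have h0 : 0 < 1 / a := by positivity
    rw [mul_one_div_cancel ha0.ne']
    gcongr
    nlinarith
  have hp := gaussianPDFReal_nonneg 0 1 a
  have h' : 2 * (1 / a) * (Real.exp (-3) * gaussianPDFReal 0 1 a) ≤ gaussianTail a :=
    le_trans (by gcongr) h
  calc 2 * gaussianPDFReal 0 1 a
      = a * Real.exp 3 * (2 * (1 / a) * (Real.exp (-3) * gaussianPDFReal 0 1 a)) := by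
        rw [Real.exp_neg]
        field_simp
    _ ≤ _ := by gcongr

lemma exists_gaussianTail_eq {y : ℝ} (hy : 0 < y) (hy1 : y ≤ 1) :
    ∃ a, 0 ≤ a ∧ gaussianTail a = y := by
  set b := √(2 * Real.log (1 / y))
  have hb : gaussianTail b ≤ y := by
    refine (gaussianTail_le_exp (Real.sqrt_nonneg _)).trans_eq ?_
    have : 0 ≤ Real.log (1 / y) := Real.log_nonneg (by rw [le_div_iff₀ hy]; linarith)
    rw [Real.sq_sqrt (by positivity), mul_div_cancel_left₀ _ two_ne_zero, one_div, Real.log_inv,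
      neg_neg, Real.exp_log hy]
  obtain ⟨a, ha, h⟩ := intermediate_value_Icc' (Real.sqrt_nonneg _ : 0 ≤ b)
    continuous_gaussianTail.continuousOn
    (show y ∈ Set.Icc _ _ from ⟨hb, by rwa [gaussianTail_zero]⟩)
  exact ⟨a, ha.1, h⟩

/-- The level exceeded by one coordinate with probability `1 / n` is of order `√(log n)`. -/
lemma exists_quantile {n : ℕ} (hn : 2 ≤ n) :
    ∃ a, 1 / 2 ≤ a ∧ gaussianTail a = 1 / n ∧ a ^ 2 ≤ 2 * Real.log n ∧
      Real.log n ≤ 22 * a ^ 2 := by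
  have hn2 : (2 : ℝ) ≤ n := by exact_mod_cast hn
  have hn0 : (0 : ℝ) < n := by linarith
  obtain ⟨a, ha, hq⟩ := exists_gaussianTail_eq (y := 1 / n) (by positivity)
    (by rw [div_le_iff₀ hn0]; linarith)
  have ha' : 1 / 2 ≤ a := half_le_of_gaussianTail_le ha (by rw [hq]; gcongr)
  have ha0 : 0 < a := by linarith
  refine ⟨a, ha', hq, ?_, ?_⟩
  · have h := gaussianTail_le_exp ha
    rw [hq] at h
    have := Real.log_le_log (by positivity) h
    rw [Real.log_exp, one_div, Real.log_inv] at this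
    linarith
  · have h := gaussianPDFReal_le_mul_gaussianTail ha'
    have h2 := gaussianPDFReal_std_add 0 a
    rw [zero_add, zero_mul, neg_zero, zero_sub] at h2
    rw [h2, hq, mul_one_div, le_div_iff₀ hn0] at h
    have h3 : Real.exp (-(a ^ 2 / 2)) * (n / 2) ≤ a * Real.exp 3 := by
      refine le_trans ?_ h
      have := one_third_le_gaussianPDFReal_std_zero
      have he := Real.exp_pos (-(a ^ 2 / 2))
      calc _ ≤ 2 * (Real.exp (-(a ^ 2 / 2)) * (1 / 3)) * n := by nlinarith [mul_pos he hn0]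
        _ ≤ _ := by gcongr
    have h4 := Real.log_le_log (by positivity) h3
    rw [Real.log_mul (by positivity) (by positivity), Real.log_exp,
      Real.log_mul (by positivity) (by positivity), Real.log_exp,
      Real.log_div hn0.ne' two_ne_zero] at h4
    have h5 := Real.log_le_sub_one_of_pos ha0
    have h6 := Real.log_le_sub_one_of_pos (zero_lt_two (α := ℝ))
    nlinarith

lemma half_le_gaussianTail_add {a y : ℝ} (ha : 1 / 2 ≤ a) (h : gaussianTail a = y) :
    y / 2 ≤ gaussianTail (a + Real.exp (-3) / (2 * a)) := by
  have ha0 : 0 < a := by linarith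
  have h1 := gaussianTail_sub_le ha0.le (d := Real.exp (-3) / (2 * a)) (by positivity)
  have h2 := gaussianPDFReal_le_mul_gaussianTail ha
  have h3 : 2 * (Real.exp (-3) / (2 * a)) * gaussianPDFReal 0 1 a ≤ y / 2 := by
    calc 2 * (Real.exp (-3) / (2 * a)) * gaussianPDFReal 0 1 a
        = (Real.exp (-3) / (2 * a)) * (2 * gaussianPDFReal 0 1 a) := by ring
      _ ≤ (Real.exp (-3) / (2 * a)) * (a * Real.exp 3 * gaussianTail a) := by gcongr
      _ = y / 2 := by
        rw [h, Real.exp_neg]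
        field_simp
  linarith

lemma integrable_sq_and_integral_sq_le {Ω : Type*} [MeasurableSpace Ω] {μ : Measure Ω}
    [IsFiniteMeasure μ] {f : Ω → ℝ} (hf : Measurable f) (hf0 : ∀ ω, 0 ≤ f ω) {r : ℝ} (hr : 0 < r)
    (h : ∀ s, 0 < s → μ.real {ω | s < f ω} ≤ 2 * Real.exp (-(r * s))) :
    Integrable (fun ω => f ω ^ 2) μ ∧ ∫ ω, f ω ^ 2 ∂μ ≤ 4 / r ^ 2 := by
  have hI : IntegrableOn (fun t : ℝ => t ^ ((2 : ℝ) - 1) * Real.exp (-(r * t))) (Set.Ioi 0) := by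
    have := integrableOn_rpow_mul_exp_neg_mul_rpow (s := 1) (p := 1) (b := r)
      (by norm_num) one_pos hr
    norm_num at this ⊢
    exact this
  have hv : ∫ t : ℝ in Set.Ioi 0, t ^ ((2 : ℝ) - 1) * Real.exp (-(r * t)) = 1 / r ^ 2 := by
    rw [Real.integral_rpow_mul_exp_neg_mul_Ioi two_pos hr]
    simp
  have hl : ∫⁻ ω, ENNReal.ofReal (f ω ^ 2) ∂μ ≤ ENNReal.ofReal (4 / r ^ 2) := by
    have hcake := lintegral_rpow_eq_lintegral_meas_lt_mul μ (ae_of_all _ hf0) hf.aemeasurable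
      (p := 2) two_pos
    simp only [Real.rpow_two] at hcake
    rw [hcake]
    calc _ ≤ ENNReal.ofReal 2 * ∫⁻ t in Set.Ioi 0,
          ENNReal.ofReal (2 * (t ^ ((2 : ℝ) - 1) * Real.exp (-(r * t)))) := by
          gcongr ENNReal.ofReal 2 * ?_
          refine setLIntegral_mono' measurableSet_Ioi fun t ht => ?_
          rw [← ofReal_measureReal, ← ENNReal.ofReal_mul measureReal_nonneg]
          apply ENNReal.ofReal_le_ofReal
          have h0 : (0 : ℝ) ≤ t ^ ((2 : ℝ) - 1) := Real.rpow_nonneg (Set.mem_Ioi.1 ht).le _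
          calc _ ≤ 2 * Real.exp (-(r * t)) * t ^ ((2 : ℝ) - 1) := by
                gcongr
                exact h t ht
            _ = _ := by ring
      _ = ENNReal.ofReal (4 / r ^ 2) := by
          rw [← ofReal_integral_eq_lintegral_ofReal (hI.const_mul 2), integral_const_mul, hv,
            ← ENNReal.ofReal_mul zero_le_two]
          · congr 1
            ring
          · refine (ae_restrict_iff' measurableSet_Ioi).2 (ae_of_all _ fun t ht => ?_)
            have h0 : (0 : ℝ) ≤ t ^ ((2 : ℝ) - 1) := Real.rpow_nonneg (Set.mem_Ioi.1 ht).le _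
            simp only [Pi.zero_apply]
            positivity
  have hnn : 0 ≤ᵐ[μ] fun ω => f ω ^ 2 := ae_of_all _ fun ω => sq_nonneg _
  have hm : AEStronglyMeasurable (fun ω => f ω ^ 2) μ := (hf.pow_const 2).aestronglyMeasurable
  refine ⟨⟨hm, ?_⟩, ?_⟩
  · rw [hasFiniteIntegral_iff_ofReal hnn]
    exact hl.trans_lt ENNReal.ofReal_lt_top
  · rw [integral_eq_lintegral_of_nonneg_ae hnn hm]
    exact ENNReal.toReal_le_of_le_ofReal (by positivity) hl

/-- A square-integrable function charging both sides of a gap of length `d` has variance at least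
of order `d ^ 2`. -/
lemma le_integral_sub_sq {Ω : Type*} [MeasurableSpace Ω] {μ : Measure Ω}
    [IsFiniteMeasure μ] {f : Ω → ℝ} (hf : Measurable f) {m : ℝ}
    (hint : Integrable (fun ω => (f ω - m) ^ 2) μ) {b d p : ℝ} (hd : 0 ≤ d)
    (h1 : p ≤ μ.real {ω | f ω ≤ b}) (h2 : p ≤ μ.real {ω | b + d < f ω}) :
    d ^ 2 / 4 * p ≤ ∫ ω, (f ω - m) ^ 2 ∂μ := by
  have key : ∀ s : Set Ω, MeasurableSet s → p ≤ μ.real s →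
      (∀ ω ∈ s, d ^ 2 / 4 ≤ (f ω - m) ^ 2) → d ^ 2 / 4 * p ≤ ∫ ω, (f ω - m) ^ 2 ∂μ := by
    intro s hs hp h
    calc d ^ 2 / 4 * p ≤ d ^ 2 / 4 * μ.real s := by gcongr
      _ ≤ ∫ ω in s, (f ω - m) ^ 2 ∂μ :=
          setIntegral_ge_of_const_le_real hs (measure_ne_top _ _) h hint.integrableOn
      _ ≤ _ := setIntegral_le_integral hint (ae_of_all _ fun ω => sq_nonneg _)
  rcases le_total (b + d / 2) m with hm | hm
  · refine key _ (measurableSet_le hf measurable_const) h1 fun ω hω => ?_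
    simp only [Set.mem_ofPred_eq] at hω
    nlinarith
  · refine key _ (measurableSet_lt measurable_const hf) h2 fun ω hω => ?_
    simp only [Set.mem_ofPred_eq] at hω
    nlinarith

lemma measurable_iSup_abs (n : ℕ) : Measurable fun x : Fin n → ℝ => ⨆ i, |x i| :=
  Measurable.iSup fun i => (measurable_pi_apply i).abs

lemma measureReal_iSup_abs_le {n : ℕ} (hn : n ≠ 0) {b : ℝ} (hb : 0 ≤ b) :
    (Measure.pi fun _ : Fin n => gaussianReal 0 1).real {x | ⨆ i, |x i| ≤ b}
      = (1 - gaussianTail b) ^ n := by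
  have : Nonempty (Fin n) := ⟨⟨0, Nat.pos_of_ne_zero hn⟩⟩
  have hset : {x : Fin n → ℝ | ⨆ i, |x i| ≤ b} = Set.univ.pi fun _ => {y : ℝ | |y| ≤ b} := by
    ext x
    simp [ciSup_le_iff (Set.finite_range fun i => |x i|).bddAbove]
  have hc : {y : ℝ | |y| ≤ b} = {y | b < |y|}ᶜ := by
    ext y
    simp
  rw [hset, Measure.real, Measure.pi_pi, ENNReal.toReal_prod]
  simp only [Finset.prod_const, Finset.card_univ, Fintype.card_fin]
  rw [← Measure.real, hc, probReal_compl_eq_one_sub (measurableSet_lt measurable_const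
    measurable_abs), gaussianReal_lt_abs hb]

lemma measureReal_lt_iSup_abs {n : ℕ} (hn : n ≠ 0) {b : ℝ} (hb : 0 ≤ b) :
    (Measure.pi fun _ : Fin n => gaussianReal 0 1).real {x | b < ⨆ i, |x i|}
      = 1 - (1 - gaussianTail b) ^ n := by
  rw [← measureReal_iSup_abs_le hn hb, ← probReal_compl_eq_one_sub
    (measurableSet_le (measurable_iSup_abs n) measurable_const)]
  congr 1
  ext x
  simp

lemma one_sub_pow_le_exp {n : ℕ} {q : ℝ} (hq : q ≤ 1) : (1 - q) ^ n ≤ Real.exp (-(n * q)) := by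
  have hq0 : 0 ≤ 1 - q := sub_nonneg.2 hq
  calc (1 - q) ^ n ≤ Real.exp (-q) ^ n := by
        gcongr
        exact Real.one_sub_le_exp_neg q
    _ = _ := by
        rw [← Real.exp_nat_mul]
        ring_nf

lemma exp_neg_two_le_one_sub_pow {n : ℕ} (hn : 2 ≤ n) : Real.exp (-2) ≤ (1 - 1 / (n : ℝ)) ^ n := by
  have hn2 : (2 : ℝ) ≤ n := by exact_mod_cast hn
  have hn0 : (0 : ℝ) < n := by linarith
  have hn1 : (0 : ℝ) < n - 1 := by linarith
  have h : Real.exp (-(2 / n)) ≤ 1 - 1 / (n : ℝ) := by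
    rw [Real.exp_neg, inv_le_comm₀ (Real.exp_pos _)
      (by rw [sub_pos, div_lt_one hn0]; linarith)]
    have h1 := Real.add_one_le_exp (1 / ((n : ℝ) - 1))
    have h2 : 1 / ((n : ℝ) - 1) ≤ 2 / n := by
      rw [div_le_div_iff₀ hn1 hn0]
      linarith
    calc (1 - 1 / (n : ℝ))⁻¹ = 1 / ((n : ℝ) - 1) + 1 := by
          rw [one_sub_div hn0.ne', inv_div, div_add_one hn1.ne']
          ring_nf
      _ ≤ _ := h1.trans (Real.exp_le_exp.2 h2)
  calc Real.exp (-2) = Real.exp (-(2 / n)) ^ n := by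
        rw [← Real.exp_nat_mul]
        field_simp
    _ ≤ _ := by gcongr

lemma measureReal_lt_abs_iSup_abs_sub {n : ℕ} (hn : n ≠ 0) {a : ℝ} (ha : 0 < a)
    (hq : gaussianTail a = 1 / n) {s : ℝ} (hs : 0 < s) :
    (Measure.pi fun _ : Fin n => gaussianReal 0 1).real {x | s < |(⨆ i, |x i|) - a|}
      ≤ 2 * Real.exp (-(a / 2 * s)) := by
  set μ := Measure.pi fun _ : Fin n => gaussianReal 0 1
  have hn0 : (0 : ℝ) < n := by positivity
  have hupper : μ.real {x | a + s < ⨆ i, |x i|} ≤ Real.exp (-(a / 2 * s)) := by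
    rw [measureReal_lt_iSup_abs hn (by positivity)]
    have h1 := gaussianTail_le_one (add_pos ha hs).le
    have h2 := one_add_mul_le_pow (a := -gaussianTail (a + s)) (by linarith) n
    rw [← sub_eq_add_neg] at h2
    have h3 := gaussianTail_add_le (t := a) hs.le
    rw [hq] at h3
    calc 1 - (1 - gaussianTail (a + s)) ^ n ≤ n * gaussianTail (a + s) := by linarith
      _ ≤ n * (Real.exp (-(a * s) - s ^ 2 / 2) * (1 / n)) := by gcongr
      _ = Real.exp (-(a * s) - s ^ 2 / 2) := by field_simp
      _ ≤ _ := by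
        gcongr
        nlinarith [mul_pos ha hs]
  have hlower : μ.real {x | ⨆ i, |x i| < a - s} ≤ Real.exp (-(a / 2 * s)) := by
    rcases le_or_gt a s with has | has
    · have : {x : Fin n → ℝ | ⨆ i, |x i| < a - s} = ∅ := by
        ext x
        have : 0 ≤ ⨆ i, |x i| := Real.iSup_nonneg fun i => abs_nonneg _
        simp only [Set.mem_ofPred_eq, Set.mem_empty_iff_false, iff_false, not_lt]
        linarith
      rw [this, measureReal_empty]
      positivity
    · have has' : 0 ≤ a - s := by linarith
      have h3 := gaussianTail_add_le (t := a - s) hs.le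
      rw [sub_add_cancel, hq] at h3
      have h4 : Real.exp (a / 2 * s) ≤ n * gaussianTail (a - s) := by
        have hexp : Real.exp (-((a - s) * s) - s ^ 2 / 2) ≤ Real.exp (-(a / 2 * s)) := by
          gcongr
          nlinarith
        have h5 := h3.trans (mul_le_mul_of_nonneg_right hexp (gaussianTail_nonneg _))
        rw [Real.exp_neg, inv_mul_eq_div, div_le_div_iff₀ hn0 (Real.exp_pos _)] at h5
        linarith
      calc μ.real {x | ⨆ i, |x i| < a - s} ≤ μ.real {x | ⨆ i, |x i| ≤ a - s} :=
            measureReal_mono (Set.ofPred_subset_ofPred.2 fun x hx => le_of_lt hx)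
        _ = (1 - gaussianTail (a - s)) ^ n := measureReal_iSup_abs_le hn has'
        _ ≤ Real.exp (-(n * gaussianTail (a - s))) := one_sub_pow_le_exp (gaussianTail_le_one has')
        _ ≤ _ := by
          rw [Real.exp_le_exp]
          linarith [Real.add_one_le_exp (a / 2 * s)]
  calc _ ≤ μ.real ({x | a + s < ⨆ i, |x i|} ∪ {x | ⨆ i, |x i| < a - s}) := by
        refine measureReal_mono fun x hx => ?_
        rcases lt_abs.1 (Set.mem_ofPred.1 hx) with h | h
        · exact Or.inl (by simp only [Set.mem_ofPred_eq]; linarith)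
        · exact Or.inr (by simp only [Set.mem_ofPred_eq]; linarith)
    _ ≤ _ := (measureReal_union_le _ _).trans (by linarith)

theorem stmt19 :
    ∃ c C : ℝ, 0 < c ∧ 0 < C ∧ ∀ n : ℕ, 2 ≤ n →
      c / Real.log n ≤
        (∫ x, ((⨆ i, |x i|) -
            ∫ y, (⨆ i, |y i|) ∂(Measure.pi fun _ : Fin n => gaussianReal 0 1)) ^ 2
          ∂(Measure.pi fun _ : Fin n => gaussianReal 0 1)) ∧
      (∫ x, ((⨆ i, |x i|) -
          ∫ y, (⨆ i, |y i|) ∂(Measure.pi fun _ : Fin n => gaussianReal 0 1)) ^ 2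
        ∂(Measure.pi fun _ : Fin n => gaussianReal 0 1)) ≤ C / Real.log n := by
  refine ⟨Real.exp (-3) ^ 2 * Real.exp (-2) / 32, 16 * 22, by positivity, by norm_num, ?_⟩
  intro n hn
  obtain ⟨a, ha, hq, hle, hge⟩ := exists_quantile hn
  have ha0 : 0 < a := by linarith
  have hn0 : n ≠ 0 := by lia
  have hlog : 0 < Real.log n := Real.log_pos (by exact_mod_cast hn)
  set μ := Measure.pi fun _ : Fin n => gaussianReal 0 1
  have hM := measurable_iSup_abs n
  obtain ⟨hint, hbound⟩ := integrable_sq_and_integral_sq_le (μ := μ) (hM.sub_const a).abs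
    (fun x => abs_nonneg _) (half_pos ha0)
    fun s hs => measureReal_lt_abs_iSup_abs_sub hn0 ha0 hq hs
  simp only [sq_abs] at hint hbound
  have hL2 : MemLp (fun x : Fin n → ℝ => ⨆ i, |x i|) 2 μ := by
    have := ((memLp_two_iff_integrable_sq (hM.sub_const a).aestronglyMeasurable).2 hint).add
      (memLp_const a)
    simpa [Pi.add_def] using this
  constructor
  · have hd : 0 < Real.exp (-3) / (2 * a) := by positivity
    refine le_trans ?_ (le_integral_sub_sq (p := Real.exp (-2)) (b := a) hM
      ((hL2.sub (memLp_const _)).integrable_sq) hd.le ?_ ?_)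
    · calc Real.exp (-3) ^ 2 * Real.exp (-2) / 32 / Real.log n
          ≤ Real.exp (-3) ^ 2 * Real.exp (-2) / 32 / (a ^ 2 / 2) := by
            gcongr
            linarith
        _ = _ := by
            field_simp
            norm_num
    · rw [measureReal_iSup_abs_le hn0 ha0.le, hq]
      exact exp_neg_two_le_one_sub_pow hn
    · have hpos : 0 ≤ a + Real.exp (-3) / (2 * a) := by positivity
      rw [measureReal_lt_iSup_abs hn0 hpos]
      have h1 := half_le_gaussianTail_add ha hq
      have h2 := one_sub_pow_le_exp (n := n) (gaussianTail_le_one hpos)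
      have h3 : (1 : ℝ) / 2 ≤ n * gaussianTail (a + Real.exp (-3) / (2 * a)) := by
        calc (1 : ℝ) / 2 = n * (1 / n / 2) := by field_simp
          _ ≤ _ := by gcongr
      have h4 : Real.exp (-(n * gaussianTail (a + Real.exp (-3) / (2 * a)))) ≤ 2 / 3 := by
        rw [Real.exp_neg]
        refine inv_le_of_inv_le₀ (by norm_num) ?_
        have := Real.add_one_le_exp (n * gaussianTail (a + Real.exp (-3) / (2 * a)))
        norm_num
        linarith
      have h5 : Real.exp (-2) ≤ 1 / 3 := by
        rw [Real.exp_neg]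
        refine inv_le_of_inv_le₀ (by norm_num) ?_
        have := Real.add_one_le_exp 2
        norm_num
        linarith
      linarith
  · calc _ = variance (fun x : Fin n → ℝ => ⨆ i, |x i|) μ :=
          (variance_eq_integral hM.aemeasurable).symm
      _ = variance (fun x : Fin n → ℝ => (⨆ i, |x i|) - a) μ :=
          (variance_sub_const hM.aestronglyMeasurable a).symm
      _ ≤ ∫ x, ((⨆ i, |x i|) - a) ^ 2 ∂μ :=
          variance_le_expectation_sq (hM.sub_const a).aestronglyMeasurable
      _ ≤ 4 / (a / 2) ^ 2 := hbound
      _ = 16 * 22 / (22 * a ^ 2) := by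
          field_simp
          norm_num
      _ ≤ 16 * 22 / Real.log n := by gcongr
end
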